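/- Let x = [[n,α],[β,n]] and y = [[m,γ],[δ,m]] be two distinct involutions (determinant 1, order 2) in the Paige loop over F₂. Then the product xy has order 2 if and only if α·δ = β·γ in F₂, and xy has order 3 if and only if α·δ ≠ β·γ. -/

import Mathlib

/-- Zorn vector matrices over the field with two elements. -/
structure Zorn2 where
  a : ZMod 2
  alpha : Fin 3 → ZMod 2
  beta : Fin 3 → ZMod 2
  b : ZMod 2

namespace Zorn2

/-- Standard dot product on `F₂³`. -/
def zdot (u v : Fin 3 → ZMod 2) : ZMod 2 := u 0 * v 0 + u 1 * v 1 + u 2 * v 2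

/-- Standard cross product on `F₂³`. -/
def zcross (u v : Fin 3 → ZMod 2) : Fin 3 → ZMod 2 :=
  ![u 1 * v 2 - u 2 * v 1, u 2 * v 0 - u 0 * v 2, u 0 * v 1 - u 1 * v 0]

/-- Zorn's vector matrix multiplication. -/
instance : Mul Zorn2 :=
  ⟨fun x y =>
    { a := x.a * y.a + zdot x.alpha y.beta
      alpha := fun i => x.a * y.alpha i + x.alpha i * y.b - zcross x.beta y.beta i
      beta := fun i => x.beta i * y.a + x.b * y.beta i + zcross x.alpha y.alpha i
      b := zdot x.beta y.alpha + x.b * y.b }⟩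

instance : One Zorn2 := ⟨{ a := 1, alpha := fun _ => 0, beta := fun _ => 0, b := 1 }⟩

instance : Add Zorn2 :=
  ⟨fun x y => { a := x.a + y.a, alpha := x.alpha + y.alpha,
                beta := x.beta + y.beta, b := x.b + y.b }⟩

/-- Determinant (norm) of a Zorn vector matrix. -/
def det (x : Zorn2) : ZMod 2 := x.a * x.b - zdot x.alpha x.beta

/-- `x` has multiplicative order 2. -/
def ord2 (x : Zorn2) : Prop := x * x = 1 ∧ x ≠ 1

/-- `x` has multiplicative order 3. -/
def ord3 (x : Zorn2) : Prop := x * (x * x) = 1 ∧ x * x ≠ 1 ∧ x ≠ 1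

end Zorn2

namespace Zorn2

theorem ext_apply {x y : Zorn2} (ha : x.a = y.a) (hα : ∀ i, x.alpha i = y.alpha i)
    (hβ : ∀ i, x.beta i = y.beta i) (hb : x.b = y.b) : x = y := by
  cases x
  cases y
  simp only [mk.injEq]
  exact ⟨ha, funext hα, funext hβ, hb⟩

@[simp] theorem mul_a (x y : Zorn2) : (x * y).a = x.a * y.a + zdot x.alpha y.beta := rfl

@[simp] theorem mul_alpha (x y : Zorn2) (i : Fin 3) :
    (x * y).alpha i = x.a * y.alpha i + x.alpha i * y.b - zcross x.beta y.beta i := rfl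

@[simp] theorem mul_beta (x y : Zorn2) (i : Fin 3) :
    (x * y).beta i = x.beta i * y.a + x.b * y.beta i + zcross x.alpha y.alpha i := rfl

@[simp] theorem mul_b (x y : Zorn2) : (x * y).b = zdot x.beta y.alpha + x.b * y.b := rfl

@[simp] theorem one_a : (1 : Zorn2).a = 1 := rfl

@[simp] theorem one_alpha (i : Fin 3) : (1 : Zorn2).alpha i = 0 := rfl

@[simp] theorem one_beta (i : Fin 3) : (1 : Zorn2).beta i = 0 := rfl

@[simp] theorem one_b : (1 : Zorn2).b = 1 := rfl

protected theorem mul_one (x : Zorn2) : x * 1 = x := by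
  refine ext_apply ?_ (fun i => ?_) (fun i => ?_) ?_ <;> try fin_cases i
  all_goals simp [zdot, zcross]

/-- The standard involution of the Zorn algebra. -/
def conj (x : Zorn2) : Zorn2 := ⟨x.b, -x.alpha, -x.beta, x.a⟩

theorem det_conj (x : Zorn2) : det (conj x) = det x := by
  simp only [det, conj, zdot, Pi.neg_apply]
  ring

theorem conj_conj (x : Zorn2) : conj (conj x) = x := by
  simp [conj]

theorem det_mul (x y : Zorn2) : det (x * y) = det x * det y := by
  simp only [det, mul_a, mul_b, zdot, mul_alpha, mul_beta, zcross, Matrix.cons_val]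
  ring

theorem conj_mul_cancel_left {x : Zorn2} (hx : det x = 1) (y : Zorn2) :
    conj x * (x * y) = y := by
  simp only [det, zdot] at hx
  refine ext_apply ?_ (fun i => ?_) (fun i => ?_) ?_
  · simp only [conj, mul_a, mul_beta, zdot, zcross, Pi.neg_apply, Matrix.cons_val]
    linear_combination y.a * hx
  · fin_cases i <;>
      simp only [conj, mul_b, mul_alpha, mul_beta, zdot, zcross, Pi.neg_apply,
        Matrix.cons_val, Fin.zero_eta, Fin.mk_one, Fin.reduceFinMk]
    · linear_combination y.alpha 0 * hx
    · linear_combination y.alpha 1 * hx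
    · linear_combination y.alpha 2 * hx
  · fin_cases i <;>
      simp only [conj, mul_a, mul_alpha, mul_beta, zdot, zcross, Pi.neg_apply,
        Matrix.cons_val, Fin.zero_eta, Fin.mk_one, Fin.reduceFinMk]
    · linear_combination y.beta 0 * hx
    · linear_combination y.beta 1 * hx
    · linear_combination y.beta 2 * hx
  · simp only [conj, mul_b, mul_alpha, zdot, zcross, Pi.neg_apply, Matrix.cons_val]
    linear_combination y.b * hx

theorem mul_conj {x : Zorn2} (hx : det x = 1) : x * conj x = 1 := by
  simpa only [conj_conj, Zorn2.mul_one] using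
    conj_mul_cancel_left ((det_conj x).trans hx) 1

theorem conj_eq_self {x : Zorn2} (hx : x.a = x.b) : conj x = x :=
  ext_apply hx.symm (fun i => ZModModule.neg_eq_self (x.alpha i))
    (fun i => ZModModule.neg_eq_self (x.beta i)) hx

/-- An element of determinant one and trace one satisfies `x² = x + 1`, which is its conjugate. -/
theorem mul_self_eq_conj {x : Zorn2} (hx : det x = 1) (h : x.a ≠ x.b) : x * x = conj x := by
  have two : (2 : ZMod 2) = 0 := rfl
  have trace : x.a + x.b = 1 := by
    generalize x.a = a at h ⊢
    generalize x.b = b at h ⊢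
    revert a b
    decide
  simp only [det, zdot] at hx
  refine ext_apply ?_ (fun i => ?_) (fun i => ?_) ?_
  · simp only [conj, mul_a, zdot]
    linear_combination (x.a + 1) * trace - hx - x.b * two
  · have hc : zcross x.beta x.beta i = 0 := by fin_cases i <;> simp [zcross, mul_comm]
    simp only [conj, mul_alpha, hc, Pi.neg_apply]
    linear_combination x.alpha i * trace + x.alpha i * two
  · have hc : zcross x.alpha x.alpha i = 0 := by fin_cases i <;> simp [zcross, mul_comm]
    simp only [conj, mul_beta, hc, Pi.neg_apply]
    linear_combination x.beta i * trace + x.beta i * two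
  · simp only [conj, mul_b, zdot]
    linear_combination (x.b + 1) * trace - hx - x.a * two

theorem mul_self_eq_one_iff {x : Zorn2} (hx : det x = 1) : x * x = 1 ↔ x.a = x.b := by
  refine ⟨fun h => ?_, fun h => ?_⟩
  · by_contra hab
    rw [mul_self_eq_conj hx hab] at h
    exact hab ((congrArg b h).trans (congrArg a h).symm)
  · simpa only [conj_eq_self h] using mul_conj hx

theorem ord3_iff {x : Zorn2} (hx : det x = 1) : ord3 x ↔ x.a ≠ x.b := by
  refine ⟨fun h => mt (mul_self_eq_one_iff hx).2 h.2.1, fun h => ⟨?_, ?_, ?_⟩⟩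
  · rw [mul_self_eq_conj hx h, mul_conj hx]
  · exact mt (mul_self_eq_one_iff hx).1 h
  · rintro rfl
    exact h rfl

end Zorn2

open Zorn2 in
theorem stmt8 (x y : Zorn2) (hxy : x ≠ y)
    (hdx : Zorn2.det x = 1) (hdy : Zorn2.det y = 1)
    (hx2 : Zorn2.ord2 x) (hy2 : Zorn2.ord2 y)
    (hxd : x.a = x.b) (hyd : y.a = y.b) :
    (Zorn2.ord2 (x * y) ↔ Zorn2.zdot x.alpha y.beta = Zorn2.zdot x.beta y.alpha) ∧
    (Zorn2.ord3 (x * y) ↔ Zorn2.zdot x.alpha y.beta ≠ Zorn2.zdot x.beta y.alpha) := by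
  have hd : det (x * y) = 1 := by rw [det_mul, hdx, hdy, mul_one]
  have ne_one : x * y ≠ 1 := fun h => hxy <| by
    have := conj_mul_cancel_left hdx y
    rwa [h, Zorn2.mul_one, conj_eq_self hxd] at this
  have diag : (x * y).a = (x * y).b ↔ zdot x.alpha y.beta = zdot x.beta y.alpha := by
    rw [mul_a, mul_b, hxd, hyd, add_comm, add_left_inj]
  exact ⟨by rw [ord2, and_iff_left ne_one, mul_self_eq_one_iff hd, diag],
    by rw [ord3_iff hd, ne_eq, diag]⟩
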